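/- Let 1 ≤ p < ∞, let X and Y be real Banach spaces, and let f ∈ Lip₀(X,Y). Then f ∈ 𝒦_p^{Ld}(X,Y) if and only if its linearization T_f ∈ 𝒦_p^d(F(X),Y), and in that case k_p^d(T_f) = k_p^{Ld}(f). -/

import Mathlib

open scoped NNReal ZeroAtInfty
open Metric Set

/-- A Lipschitz map vanishing at `0` (an element of `Lip₀(X, Y)`). -/
def IsLip0 {X Y : Type*} [NormedAddCommGroup X] [NormedAddCommGroup Y] (f : X → Y) : Prop :=
  f 0 = 0 ∧ ∃ K : ℝ≥0, LipschitzWith K f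

/-- `a` belongs to the closed unit ball of `ℓ_{p'}`, where `p'` is the conjugate exponent of
`p` (`p' = ∞` when `p = 1`, `p' = p / (p - 1)` when `p > 1`). -/
def InBallConj (p : ℝ) (a : ℕ → ℝ) : Prop :=
  (p = 1 ∧ ∀ n, |a n| ≤ 1) ∨
    (p ≠ 1 ∧ Summable (fun n => |a n| ^ (p / (p - 1))) ∧ (∑' n, |a n| ^ (p / (p - 1))) ≤ 1)

/-- `K` is relatively `p`-compact: `K` is contained in the `p`-convex hull of a strongly
`p`-summable sequence. -/
def RelPCompact (p : ℝ) {Z : Type*} [NormedAddCommGroup Z] [NormedSpace ℝ Z]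
    (K : Set Z) : Prop :=
  ∃ z : ℕ → Z, Summable (fun n => ‖z n‖ ^ p) ∧
    ∀ w ∈ K, ∃ a : ℕ → ℝ, InBallConj p a ∧ HasSum (fun n => a n • z n) w

/-- A `p`-compact bounded linear operator: it maps the closed unit ball to a relatively
`p`-compact set. -/
def PCompactOp (p : ℝ) {Z W : Type*} [NormedAddCommGroup Z] [NormedSpace ℝ Z]
    [NormedAddCommGroup W] [NormedSpace ℝ W] (T : Z →L[ℝ] W) : Prop :=
  RelPCompact p (T '' Metric.closedBall (0 : Z) 1)

/-- The `p`-compactness norm `k_p(T)`: the infimum of `(Σ ‖w n‖ ^ p) ^ (1/p)` over all strongly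
`p`-summable sequences `w` whose `p`-convex hull contains the image of the closed unit ball. -/
noncomputable def kp (p : ℝ) {Z W : Type*} [NormedAddCommGroup Z] [NormedSpace ℝ Z]
    [NormedAddCommGroup W] [NormedSpace ℝ W] (T : Z →L[ℝ] W) : ℝ :=
  sInf { c : ℝ | ∃ w : ℕ → W, Summable (fun n => ‖w n‖ ^ p) ∧
    (∀ v ∈ T '' Metric.closedBall (0 : Z) 1,
      ∃ a : ℕ → ℝ, InBallConj p a ∧ HasSum (fun n => a n • w n) v) ∧
    c = (∑' n, ‖w n‖ ^ p) ^ (1 / p) }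

/-- `δ : X → FX` realizes `FX` as the Lipschitz-free space `F(X)` over `X`: `δ` is an isometry
vanishing at `0` whose range has dense linear span, and every Lipschitz map `f` vanishing at `0`
into a Banach space admits a (unique, by density) bounded linear factorization `T` through `δ`
with `‖T‖ ≤ Lip(f)`. -/
structure IsFreeSpace {X FX : Type*} [NormedAddCommGroup X] [NormedSpace ℝ X]
    [NormedAddCommGroup FX] [NormedSpace ℝ FX] (δ : X → FX) : Prop where
  map_zero : δ 0 = 0
  isometry : Isometry δ
  dense_span : Dense ((Submodule.span ℝ (Set.range δ) : Submodule ℝ FX) : Set FX)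
  lift : ∀ {Y : Type*} [NormedAddCommGroup Y] [NormedSpace ℝ Y] [CompleteSpace Y]
      (f : X → Y) (K : ℝ≥0), f 0 = 0 → LipschitzWith K f →
      ∃ T : FX →L[ℝ] Y, (∀ x, T (δ x) = f x) ∧ ‖T‖ ≤ K

/-- `e` realizes `Xs` as the Lipschitz dual `X^# = Lip₀(X, ℝ)`: `e` is a linear bijection of
`Xs` onto the space of real-valued Lipschitz functions on `X` vanishing at `0`, and the norm on
`Xs` is the Lipschitz constant. -/
structure IsLipDual {X Xs : Type*} [NormedAddCommGroup X] [NormedAddCommGroup Xs]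
    [NormedSpace ℝ Xs] (e : Xs →ₗ[ℝ] (X → ℝ)) : Prop where
  inj : Function.Injective e
  surj : ∀ g : X → ℝ, g 0 = 0 → (∃ K : ℝ≥0, LipschitzWith K g) → ∃ h : Xs, e h = g
  map_zero_pt : ∀ h : Xs, e h 0 = 0
  lip_norm : ∀ h : Xs, LipschitzWith ‖h‖₊ (e h)
  norm_le : ∀ (h : Xs) (K : ℝ≥0), LipschitzWith K (e h) → ‖h‖ ≤ (K : ℝ)

/-- The adjoint (dual/transpose) `T* : W* → Z*` of a bounded linear operator `T : Z → W`. -/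
noncomputable def adjointCLM {Z W : Type*} [NormedAddCommGroup Z] [NormedSpace ℝ Z]
    [NormedAddCommGroup W] [NormedSpace ℝ W] (T : Z →L[ℝ] W) :
    (W →L[ℝ] ℝ) →L[ℝ] (Z →L[ℝ] ℝ) :=
  LinearMap.mkContinuous
    { toFun := fun ψ => ψ.comp T
      map_add' := fun ψ₁ ψ₂ => by ext z; simp
      map_smul' := fun c ψ => by ext z; simp }
    ‖T‖ (fun ψ => by simpa [mul_comm] using ψ.opNorm_comp_le T)

@[simp]
theorem adjointCLM_apply {Z W : Type*} [NormedAddCommGroup Z] [NormedSpace ℝ Z]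
    [NormedAddCommGroup W] [NormedSpace ℝ W] (T : Z →L[ℝ] W) (ψ : W →L[ℝ] ℝ) (z : Z) :
    adjointCLM T ψ z = ψ (T z) :=
  rfl

section Transfer

variable {p : ℝ} {Z W V : Type*} [NormedAddCommGroup Z] [NormedSpace ℝ Z]
  [NormedAddCommGroup W] [NormedSpace ℝ W] [NormedAddCommGroup V] [NormedSpace ℝ V]
  {S : Z →L[ℝ] W} {R : Z →L[ℝ] V}

/-- A linear isometry sends sequences witnessing `p`-compactness of `S` to sequences witnessing
`p`-compactness of its composition with `S`. -/
theorem LinearIsometry.pConvexHull_image (Φ : W →ₗᵢ[ℝ] V) (h : ∀ z, Φ (S z) = R z)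
    {w : ℕ → W}
    (hw : ∀ v ∈ S '' closedBall (0 : Z) 1,
      ∃ a : ℕ → ℝ, InBallConj p a ∧ HasSum (fun n => a n • w n) v) :
    ∀ v ∈ R '' closedBall (0 : Z) 1,
      ∃ a : ℕ → ℝ, InBallConj p a ∧ HasSum (fun n => a n • Φ (w n)) v := by
  rintro _ ⟨z, hz, rfl⟩
  obtain ⟨a, ha, hs⟩ := hw (S z) ⟨z, hz, rfl⟩
  refine ⟨a, ha, ?_⟩
  simpa [Function.comp_def, h] using Φ.toContinuousLinearMap.hasSum hs

theorem PCompactOp.of_linearIsometry (Φ : W →ₗᵢ[ℝ] V) (h : ∀ z, Φ (S z) = R z)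
    (hS : PCompactOp p S) : PCompactOp p R := by
  obtain ⟨w, hsum, hw⟩ := hS
  exact ⟨fun n => Φ (w n), by simpa using hsum, Φ.pConvexHull_image h hw⟩

theorem pCompactOp_iff_of_linearIsometryEquiv (Φ : W ≃ₗᵢ[ℝ] V) (h : ∀ z, Φ (S z) = R z) :
    PCompactOp p S ↔ PCompactOp p R :=
  ⟨.of_linearIsometry Φ.toLinearIsometry h,
    .of_linearIsometry Φ.symm.toLinearIsometry fun z => by simp [← h]⟩

theorem kp_eq_of_linearIsometryEquiv (Φ : W ≃ₗᵢ[ℝ] V) (h : ∀ z, Φ (S z) = R z) :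
    kp p S = kp p R := by
  unfold kp
  congr 1
  ext c
  constructor
  · rintro ⟨w, hsum, hw, rfl⟩
    exact ⟨fun n => Φ (w n), by simpa using hsum,
      Φ.toLinearIsometry.pConvexHull_image h hw, by simp⟩
  · rintro ⟨w, hsum, hw, rfl⟩
    exact ⟨fun n => Φ.symm (w n), by simpa using hsum,
      Φ.symm.toLinearIsometry.pConvexHull_image (fun z => by simp [← h]) hw, by simp⟩

end Transfer

section FreeSpace

variable {X FX Xs : Type*} [NormedAddCommGroup X] [NormedSpace ℝ X]
  [NormedAddCommGroup FX] [NormedSpace ℝ FX] [NormedAddCommGroup Xs] [NormedSpace ℝ Xs]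
  {δ : X → FX} {e : Xs →ₗ[ℝ] (X → ℝ)}

theorem IsFreeSpace.ext (hδ : IsFreeSpace δ) {φ ψ : FX →L[ℝ] ℝ}
    (h : ∀ x, φ (δ x) = ψ (δ x)) : φ = ψ :=
  ContinuousLinearMap.ext_on hδ.dense_span (by rintro _ ⟨x, rfl⟩; exact h x)

theorem IsFreeSpace.exists_functional (hδ : IsFreeSpace δ) {g : X → ℝ} {K : ℝ≥0}
    (h0 : g 0 = 0) (hg : LipschitzWith K g) :
    ∃ φ : FX →L[ℝ] ℝ, (∀ x, φ (δ x) = g x) ∧ ‖φ‖ ≤ K := by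
  obtain ⟨T, hT, hn⟩ := hδ.lift (fun x => ULift.up (g x)) K (by rw [h0]; rfl)
    (fun x y => hg x y)
  refine ⟨LinearMap.mkContinuous
    { toFun := fun v => (T v).down
      map_add' := fun a b => by simp
      map_smul' := fun c a => by simp } K fun v => ?_, fun x => ?_, ?_⟩
  · exact (T.le_opNorm v).trans (by gcongr)
  · exact congrArg ULift.down (hT x)
  · exact LinearMap.mkContinuous_norm_le _ K.2 _

theorem IsLipDual.exists_comp (hδ : IsFreeSpace δ) (he : IsLipDual e) (φ : FX →L[ℝ] ℝ) :
    ∃ h : Xs, ∀ x, e h x = φ (δ x) := by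
  obtain ⟨h, hh⟩ := he.surj (fun x => φ (δ x)) (by simp [hδ.map_zero])
    ⟨_, φ.lipschitz.comp hδ.isometry.lipschitz⟩
  exact ⟨h, fun x => congrFun hh x⟩

theorem IsLipDual.norm_eq (hδ : IsFreeSpace δ) (he : IsLipDual e) {φ : FX →L[ℝ] ℝ} {h : Xs}
    (hh : ∀ x, e h x = φ (δ x)) : ‖h‖ = ‖φ‖ := by
  apply le_antisymm
  · refine he.norm_le h ‖φ‖₊ ?_
    rw [show e h = φ ∘ δ from funext hh]
    simpa using φ.lipschitz.comp hδ.isometry.lipschitz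
  · obtain ⟨ψ, hψ, hn⟩ := hδ.exists_functional (he.map_zero_pt h) (he.lip_norm h)
    rwa [hδ.ext (φ := φ) (ψ := ψ) fun x => by rw [hψ, hh]]

/-- The dual of the Lipschitz-free space over `X` is isometric to the Lipschitz dual of `X`. -/
theorem IsLipDual.exists_linearIsometryEquiv (hδ : IsFreeSpace δ) (he : IsLipDual e) :
    ∃ Φ : (FX →L[ℝ] ℝ) ≃ₗᵢ[ℝ] Xs, ∀ φ x, e (Φ φ) x = φ (δ x) := by
  choose G hG using he.exists_comp hδ
  let L : (FX →L[ℝ] ℝ) →ₗᵢ[ℝ] Xs :=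
    { toFun := G
      map_add' := fun φ ψ => he.inj <| funext fun x => by simp [hG]
      map_smul' := fun c φ => he.inj <| funext fun x => by simp [hG]
      norm_map' := fun φ => he.norm_eq hδ (hG φ) }
  refine ⟨LinearIsometryEquiv.ofSurjective L fun h => ?_, hG⟩
  obtain ⟨φ, hφ, -⟩ := hδ.exists_functional (he.map_zero_pt h) (he.lip_norm h)
  exact ⟨φ, he.inj <| funext fun x => (hG φ x).trans (hφ x)⟩

end FreeSpace

theorem stmt_16 (p : ℝ) (hp : 1 ≤ p) {X Y FX Xs : Type*}
    [NormedAddCommGroup X] [NormedSpace ℝ X] [CompleteSpace X]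
    [NormedAddCommGroup Y] [NormedSpace ℝ Y] [CompleteSpace Y]
    [NormedAddCommGroup FX] [NormedSpace ℝ FX] [CompleteSpace FX]
    [NormedAddCommGroup Xs] [NormedSpace ℝ Xs] [CompleteSpace Xs]
    (δ : X → FX) (hδ : IsFreeSpace δ)
    (e : Xs →ₗ[ℝ] (X → ℝ)) (he : IsLipDual e)
    (f : X → Y) (hf : IsLip0 f)
    (Tf : FX →L[ℝ] Y) (hTf : ∀ x : X, Tf (δ x) = f x)
    (ft : (Y →L[ℝ] ℝ) →L[ℝ] Xs)
    (hft : ∀ (ψ : Y →L[ℝ] ℝ) (x : X), e (ft ψ) x = ψ (f x)) :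
    (PCompactOp p ft ↔ PCompactOp p (adjointCLM Tf)) ∧
      (PCompactOp p ft → kp p (adjointCLM Tf) = kp p ft) := by
  obtain ⟨Φ, hΦ⟩ := he.exists_linearIsometryEquiv hδ
  have h : ∀ ψ, Φ (adjointCLM Tf ψ) = ft ψ := fun ψ =>
    he.inj <| funext fun x => by rw [hΦ, hft, adjointCLM_apply, hTf]
  exact ⟨(pCompactOp_iff_of_linearIsometryEquiv Φ h).symm,
    fun _ => kp_eq_of_linearIsometryEquiv Φ h⟩
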